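/- arXiv:2303.10658 — 2 statements merged into one kernel-verified Lean document; each statement's English description precedes it below -/
import Mathlib

section
/- Let F¹², F¹³, F²³ be fundamental matrices with epipoles e_j^i. There exist cameras P₁, P₂, P₃ with non-collinear centers and nonzero scalars λ_{ij} such that λ_{ij} F^{ij} = ψ(Pᵢ,Pⱼ) for all i < j if and only if: e₁² is not parallel to e₁³, e₂¹ is not parallel to e₂³, e₃¹ is not parallel to e₃², and (e₁³)ᵀ F¹² e₂³ = 0, (e₁²)ᵀ F¹³ e₃² = 0, (e₂¹)ᵀ F²³ e₃¹ = 0. -/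
open Matrix

/-- The 6×6 matrix whose first three rows form the block `[P₁ | x | 0]` and whose last
three rows form the block `[P₂ | 0 | y]`. -/
noncomputable def bigMat (P₁ P₂ : Matrix (Fin 3) (Fin 4) ℝ) (x y : Fin 3 → ℝ) :
    Matrix (Fin 6) (Fin 6) ℝ :=
  fun i j =>
    if hi : (i : ℕ) < 3 then
      if hj : (j : ℕ) < 4 then P₁ ⟨(i : ℕ), hi⟩ ⟨(j : ℕ), hj⟩
      else if (j : ℕ) = 4 then x ⟨(i : ℕ), hi⟩ else 0
    else
      if hj : (j : ℕ) < 4 then P₂ ⟨(i : ℕ) - 3, by have := i.isLt; omega⟩ ⟨(j : ℕ), hj⟩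
      else if (j : ℕ) = 4 then 0
      else y ⟨(i : ℕ) - 3, by have := i.isLt; omega⟩

/-- `psi P₁ P₂` is the unique 3×3 matrix `F` such that for all `x y : ℝ³`,
`xᵀ F y = det [P₁ | x | 0; P₂ | 0 | y]`.  (Since the determinant is bilinear in `(x, y)`,
this matrix is obtained by evaluating at pairs of standard basis vectors.) -/
noncomputable def psi (P₁ P₂ : Matrix (Fin 3) (Fin 4) ℝ) : Matrix (Fin 3) (Fin 3) ℝ :=
  fun a b => (bigMat P₁ P₂ (Pi.single a 1) (Pi.single b 1)).det

/-- A camera is a real 3×4 matrix of rank 3. -/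
def IsCamera (P : Matrix (Fin 3) (Fin 4) ℝ) : Prop := P.rank = 3


noncomputable def psiB (P₁ P₂ : Matrix (Fin 3) (Fin 4) ℝ) :
    (Fin 3 → ℝ) →ₗ[ℝ] (Fin 3 → ℝ) →ₗ[ℝ] ℝ :=
  LinearMap.mk₂ ℝ (fun x y => (bigMat P₁ P₂ x y).det)
    (by
      intro x x' y
      have h : ∀ z, bigMat P₁ P₂ z y = (bigMat P₁ P₂ 0 y).updateCol 4
          (fun i => if hi : (i : ℕ) < 3 then z ⟨i, hi⟩ else 0) := by
        intro z; ext i j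
        fin_cases i <;> fin_cases j <;> simp [bigMat]
      rw [h (x + x'), h x, h x', ← det_updateCol_add]
      congr 2; ext i; by_cases hi : (i : ℕ) < 3 <;> simp [hi])
    (by
      intro c x y
      have h : ∀ z, bigMat P₁ P₂ z y = (bigMat P₁ P₂ 0 y).updateCol 4
          (fun i => if hi : (i : ℕ) < 3 then z ⟨i, hi⟩ else 0) := by
        intro z; ext i j
        fin_cases i <;> fin_cases j <;> simp [bigMat]
      rw [h (c • x), h x, smul_eq_mul, ← det_updateCol_smul]
      congr 2; ext i; by_cases hi : (i : ℕ) < 3 <;> simp [hi])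
    (by
      intro x y y'
      have h : ∀ z, bigMat P₁ P₂ x z = (bigMat P₁ P₂ x 0).updateCol 5
          (fun i => if hi : (i : ℕ) < 3 then 0 else z ⟨(i : ℕ) - 3, by have := i.isLt; omega⟩) := by
        intro z; ext i j
        fin_cases i <;> fin_cases j <;> simp [bigMat]
      rw [h (y + y'), h y, h y', ← det_updateCol_add]
      congr 2; ext i; by_cases hi : (i : ℕ) < 3 <;> simp [hi])
    (by
      intro c x y
      have h : ∀ z, bigMat P₁ P₂ x z = (bigMat P₁ P₂ x 0).updateCol 5
          (fun i => if hi : (i : ℕ) < 3 then 0 else z ⟨(i : ℕ) - 3, by have := i.isLt; omega⟩) := by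
        intro z; ext i j
        fin_cases i <;> fin_cases j <;> simp [bigMat]
      rw [h (c • y), h y, smul_eq_mul, ← det_updateCol_smul]
      congr 2; ext i; by_cases hi : (i : ℕ) < 3 <;> simp [hi])

lemma psi_form (P₁ P₂ : Matrix (Fin 3) (Fin 4) ℝ) (x y : Fin 3 → ℝ) :
    x ⬝ᵥ (psi P₁ P₂ *ᵥ y) = (bigMat P₁ P₂ x y).det := by
  have h : psi P₁ P₂ = LinearMap.toMatrix₂' ℝ (psiB P₁ P₂) := by
    ext a b
    rw [LinearMap.toMatrix₂'_apply, psiB, LinearMap.mk₂_apply, psi]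
  rw [h, ← Matrix.toLinearMap₂'_apply', Matrix.toLinearMap₂'_toMatrix']
  rfl

lemma psi_zero (P₁ P₂ : Matrix (Fin 3) (Fin 4) ℝ) (x y : Fin 3 → ℝ) (c : Fin 4 → ℝ) (s t : ℝ)
    (hc : c ≠ 0) (h1 : P₁ *ᵥ c = s • x) (h2 : P₂ *ᵥ c = t • y) :
    x ⬝ᵥ (psi P₁ P₂ *ᵥ y) = 0 := by
  rw [psi_form]
  apply Matrix.exists_mulVec_eq_zero_iff.1
  refine ⟨![c 0, c 1, c 2, c 3, -s, -t], ?_, ?_⟩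
  · intro h
    apply hc
    ext i
    fin_cases i
    · exact congrFun h 0
    · exact congrFun h 1
    · exact congrFun h 2
    · exact congrFun h 3
  · have e1 := fun i => congrFun h1 i
    have e2 := fun i => congrFun h2 i
    simp only [mulVec, dotProduct, Fin.sum_univ_succ, Pi.smul_apply, smul_eq_mul] at e1 e2
    ext i
    fin_cases i
    · have := e1 0
      simp [bigMat, mulVec, dotProduct, Fin.sum_univ_succ] at this ⊢; linarith
    · have := e1 1
      simp [bigMat, mulVec, dotProduct, Fin.sum_univ_succ] at this ⊢; linarith
    · have := e1 2
      simp [bigMat, mulVec, dotProduct, Fin.sum_univ_succ] at this ⊢; linarith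
    · have := e2 0
      simp [bigMat, mulVec, dotProduct, Fin.sum_univ_succ] at this ⊢; linarith
    · have := e2 1
      simp [bigMat, mulVec, dotProduct, Fin.sum_univ_succ] at this ⊢; linarith
    · have := e2 2
      simp [bigMat, mulVec, dotProduct, Fin.sum_univ_succ] at this ⊢; linarith

lemma bigMat_mul (A B : Matrix (Fin 3) (Fin 3) ℝ) (Q₁ Q₂ : Matrix (Fin 3) (Fin 4) ℝ)
    (x y : Fin 3 → ℝ) :
    (bigMat (A * Q₁) (B * Q₂) (A *ᵥ x) (B *ᵥ y)).det =
      A.det * B.det * (bigMat Q₁ Q₂ x y).det := by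
  rw [← det_fromBlocks_zero₂₁ A 0 B,
    ← det_reindex_self (finSumFinEquiv : Fin 3 ⊕ Fin 3 ≃ Fin 6), ← det_mul]
  congr 1
  ext i j
  rw [mul_apply, ← (finSumFinEquiv : Fin 3 ⊕ Fin 3 ≃ Fin 6).sum_comp]
  obtain ⟨i, rfl⟩ := (finSumFinEquiv : Fin 3 ⊕ Fin 3 ≃ Fin 6).surjective i
  have v1 : ∀ i : Fin 3,
      (((finSumFinEquiv : Fin 3 ⊕ Fin 3 ≃ Fin 6) (Sum.inl i) : Fin 6) : ℕ) = i := fun i => rfl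
  have v2 : ∀ i : Fin 3,
      (((finSumFinEquiv : Fin 3 ⊕ Fin 3 ≃ Fin 6) (Sum.inr i) : Fin 6) : ℕ) = 3 + i := fun i => rfl
  rcases i with i | i <;> fin_cases j <;>
    simp [v1, v2, bigMat, mul_apply, mulVec, dotProduct, Fin.sum_univ_succ]

lemma psi_mul (A B : Matrix (Fin 3) (Fin 3) ℝ) (Q₁ Q₂ : Matrix (Fin 3) (Fin 4) ℝ) :
    Aᵀ * psi (A * Q₁) (B * Q₂) * B = (A.det * B.det) • psi Q₁ Q₂ := by
  ext i j
  have h := bigMat_mul A B Q₁ Q₂ (Pi.single i 1) (Pi.single j 1)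
  rw [← psi_form, ← psi_form] at h
  simp only [mulVec_single_one, single_one_dotProduct] at h
  rw [Matrix.smul_apply, smul_eq_mul]
  rw [show psi Q₁ Q₂ i j = (psi Q₁ Q₂).col j i from rfl, ← h, mul_assoc, mul_apply]
  rfl

def Q1 : Matrix (Fin 3) (Fin 4) ℝ := !![0,1,0,0;0,0,1,0;0,0,0,1]
def Q2 : Matrix (Fin 3) (Fin 4) ℝ := !![1,0,0,0;0,0,1,0;0,0,0,1]
def Q3 : Matrix (Fin 3) (Fin 4) ℝ := !![1,0,0,0;0,1,0,0;0,0,0,1]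

lemma psi_entry (P₁ P₂ : Matrix (Fin 3) (Fin 4) ℝ) (i j : Fin 3) :
    psi P₁ P₂ i j = Pi.single i 1 ⬝ᵥ (psi P₁ P₂ *ᵥ Pi.single j 1) := by
  rw [psi_form]; rfl

lemma psi12 : ∃ e : ℝ, e ≠ 0 ∧ psi Q1 Q2 = e • !![0,0,0;0,0,1;0,-1,0] := by
  refine ⟨psi Q1 Q2 1 2, ?_, ?_⟩
  · rw [psi]
    intro h
    obtain ⟨v, hv, hz⟩ := Matrix.exists_mulVec_eq_zero_iff.2 h
    apply hv
    have z0 := congrFun hz 0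
    have z1 := congrFun hz 1
    have z2 := congrFun hz 2
    have z3 := congrFun hz 3
    have z4 := congrFun hz 4
    have z5 := congrFun hz 5
    simp [bigMat, Q1, Q2, mulVec, dotProduct, Fin.sum_univ_succ] at z0 z1 z2 z3 z4 z5
    ext r
    fin_cases r <;> simp <;> linarith
  · have E := fun r s => psi_entry Q1 Q2 r s
    have h00 : psi Q1 Q2 0 0 = 0 := by
      rw [E]
      refine psi_zero Q1 Q2 _ _ (Pi.single 1 1) 1 0 (by simp) ?_ ?_ <;>
        (ext r; fin_cases r <;> simp [Q1, Q2])
    have h01 : psi Q1 Q2 0 1 = 0 := by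
      rw [E]
      refine psi_zero Q1 Q2 _ _ (Pi.single 1 1) 1 0 (by simp) ?_ ?_ <;>
        (ext r; fin_cases r <;> simp [Q1, Q2])
    have h02 : psi Q1 Q2 0 2 = 0 := by
      rw [E]
      refine psi_zero Q1 Q2 _ _ (Pi.single 1 1) 1 0 (by simp) ?_ ?_ <;>
        (ext r; fin_cases r <;> simp [Q1, Q2])
    have h10 : psi Q1 Q2 1 0 = 0 := by
      rw [E]
      refine psi_zero Q1 Q2 _ _ (Pi.single 0 1) 0 1 (by simp) ?_ ?_ <;>
        (ext r; fin_cases r <;> simp [Q1, Q2])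
    have h11 : psi Q1 Q2 1 1 = 0 := by
      rw [E]
      refine psi_zero Q1 Q2 _ _ (Pi.single 2 1) 1 1 (by simp) ?_ ?_ <;>
        (ext r; fin_cases r <;> simp [Q1, Q2])
    have h20 : psi Q1 Q2 2 0 = 0 := by
      rw [E]
      refine psi_zero Q1 Q2 _ _ (Pi.single 0 1) 0 1 (by simp) ?_ ?_ <;>
        (ext r; fin_cases r <;> simp [Q1, Q2])
    have h22 : psi Q1 Q2 2 2 = 0 := by
      rw [E]
      refine psi_zero Q1 Q2 _ _ (Pi.single 3 1) 1 1 (by simp) ?_ ?_ <;>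
        (ext r; fin_cases r <;> simp [Q1, Q2])
    have ha : psi Q1 Q2 2 1 = - psi Q1 Q2 1 2 := by
      have := psi_zero Q1 Q2 (Pi.single 1 1 + Pi.single 2 1) (Pi.single 1 1 + Pi.single 2 1)
        (Pi.single 2 1 + Pi.single 3 1) 1 1 (fun h => by simpa using congrFun h 3)
        (by rw [mulVec_add]; ext r; fin_cases r <;> simp [Q1])
        (by rw [mulVec_add]; ext r; fin_cases r <;> simp [Q2])
      rw [mulVec_add, add_dotProduct, dotProduct_add, dotProduct_add, ← E, ← E, ← E, ← E, h22,
        h11] at this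
      linarith
    ext r s
    fin_cases r <;> fin_cases s <;> simp [h00, h01, h02, h10, h11, h20, h22, ha]

lemma psi13 : ∃ e : ℝ, e ≠ 0 ∧ psi Q1 Q3 = e • !![0,0,1;0,0,0;0,-1,0] := by
  refine ⟨psi Q1 Q3 0 2, ?_, ?_⟩
  · rw [psi]
    intro h
    obtain ⟨v, hv, hz⟩ := Matrix.exists_mulVec_eq_zero_iff.2 h
    apply hv
    have z0 := congrFun hz 0
    have z1 := congrFun hz 1
    have z2 := congrFun hz 2
    have z3 := congrFun hz 3
    have z4 := congrFun hz 4
    have z5 := congrFun hz 5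
    simp [bigMat, Q1, Q3, mulVec, dotProduct, Fin.sum_univ_succ] at z0 z1 z2 z3 z4 z5
    ext r
    fin_cases r <;> simp <;> linarith
  · have E := fun r s => psi_entry Q1 Q3 r s
    have h00 : psi Q1 Q3 0 0 = 0 := by
      rw [E]
      refine psi_zero Q1 Q3 _ _ (Pi.single 0 1) 0 1 (by simp) ?_ ?_ <;>
        (ext r; fin_cases r <;> simp [Q1, Q3])
    have h01 : psi Q1 Q3 0 1 = 0 := by
      rw [E]
      refine psi_zero Q1 Q3 _ _ (Pi.single 1 1) 1 1 (by simp) ?_ ?_ <;>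
        (ext r; fin_cases r <;> simp [Q1, Q3])
    have h10 : psi Q1 Q3 1 0 = 0 := by
      rw [E]
      refine psi_zero Q1 Q3 _ _ (Pi.single 2 1) 1 0 (by simp) ?_ ?_ <;>
        (ext r; fin_cases r <;> simp [Q1, Q3])
    have h11 : psi Q1 Q3 1 1 = 0 := by
      rw [E]
      refine psi_zero Q1 Q3 _ _ (Pi.single 2 1) 1 0 (by simp) ?_ ?_ <;>
        (ext r; fin_cases r <;> simp [Q1, Q3])
    have h12 : psi Q1 Q3 1 2 = 0 := by
      rw [E]
      refine psi_zero Q1 Q3 _ _ (Pi.single 2 1) 1 0 (by simp) ?_ ?_ <;>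
        (ext r; fin_cases r <;> simp [Q1, Q3])
    have h20 : psi Q1 Q3 2 0 = 0 := by
      rw [E]
      refine psi_zero Q1 Q3 _ _ (Pi.single 0 1) 0 1 (by simp) ?_ ?_ <;>
        (ext r; fin_cases r <;> simp [Q1, Q3])
    have h22 : psi Q1 Q3 2 2 = 0 := by
      rw [E]
      refine psi_zero Q1 Q3 _ _ (Pi.single 3 1) 1 1 (by simp) ?_ ?_ <;>
        (ext r; fin_cases r <;> simp [Q1, Q3])
    have ha : psi Q1 Q3 2 1 = - psi Q1 Q3 0 2 := by
      have := psi_zero Q1 Q3 (Pi.single 0 1 + Pi.single 2 1) (Pi.single 1 1 + Pi.single 2 1)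
        (Pi.single 1 1 + Pi.single 3 1) 1 1 (fun h => by simpa using congrFun h 3)
        (by rw [mulVec_add]; ext r; fin_cases r <;> simp [Q1])
        (by rw [mulVec_add]; ext r; fin_cases r <;> simp [Q3])
      rw [mulVec_add, add_dotProduct, dotProduct_add, dotProduct_add, ← E, ← E, ← E, ← E, h22,
        h01] at this
      linarith
    ext r s
    fin_cases r <;> fin_cases s <;> simp [h00, h01, h10, h11, h12, h20, h22, ha]

lemma psi23 : ∃ e : ℝ, e ≠ 0 ∧ psi Q2 Q3 = e • !![0,0,1;0,0,0;-1,0,0] := by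
  refine ⟨psi Q2 Q3 0 2, ?_, ?_⟩
  · rw [psi]
    intro h
    obtain ⟨v, hv, hz⟩ := Matrix.exists_mulVec_eq_zero_iff.2 h
    apply hv
    have z0 := congrFun hz 0
    have z1 := congrFun hz 1
    have z2 := congrFun hz 2
    have z3 := congrFun hz 3
    have z4 := congrFun hz 4
    have z5 := congrFun hz 5
    simp [bigMat, Q2, Q3, mulVec, dotProduct, Fin.sum_univ_succ] at z0 z1 z2 z3 z4 z5
    ext r
    fin_cases r <;> simp <;> linarith
  · have E := fun r s => psi_entry Q2 Q3 r s
    have h00 : psi Q2 Q3 0 0 = 0 := by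
      rw [E]
      refine psi_zero Q2 Q3 _ _ (Pi.single 0 1) 1 1 (by simp) ?_ ?_ <;>
        (ext r; fin_cases r <;> simp [Q2, Q3])
    have h01 : psi Q2 Q3 0 1 = 0 := by
      rw [E]
      refine psi_zero Q2 Q3 _ _ (Pi.single 1 1) 0 1 (by simp) ?_ ?_ <;>
        (ext r; fin_cases r <;> simp [Q2, Q3])
    have h10 : psi Q2 Q3 1 0 = 0 := by
      rw [E]
      refine psi_zero Q2 Q3 _ _ (Pi.single 2 1) 1 0 (by simp) ?_ ?_ <;>
        (ext r; fin_cases r <;> simp [Q2, Q3])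
    have h11 : psi Q2 Q3 1 1 = 0 := by
      rw [E]
      refine psi_zero Q2 Q3 _ _ (Pi.single 2 1) 1 0 (by simp) ?_ ?_ <;>
        (ext r; fin_cases r <;> simp [Q2, Q3])
    have h12 : psi Q2 Q3 1 2 = 0 := by
      rw [E]
      refine psi_zero Q2 Q3 _ _ (Pi.single 2 1) 1 0 (by simp) ?_ ?_ <;>
        (ext r; fin_cases r <;> simp [Q2, Q3])
    have h21 : psi Q2 Q3 2 1 = 0 := by
      rw [E]
      refine psi_zero Q2 Q3 _ _ (Pi.single 1 1) 0 1 (by simp) ?_ ?_ <;>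
        (ext r; fin_cases r <;> simp [Q2, Q3])
    have h22 : psi Q2 Q3 2 2 = 0 := by
      rw [E]
      refine psi_zero Q2 Q3 _ _ (Pi.single 3 1) 1 1 (by simp) ?_ ?_ <;>
        (ext r; fin_cases r <;> simp [Q2, Q3])
    have ha : psi Q2 Q3 2 0 = - psi Q2 Q3 0 2 := by
      have := psi_zero Q2 Q3 (Pi.single 0 1 + Pi.single 2 1) (Pi.single 0 1 + Pi.single 2 1)
        (Pi.single 0 1 + Pi.single 3 1) 1 1 (fun h => by simpa using congrFun h 3)
        (by rw [mulVec_add]; ext r; fin_cases r <;> simp [Q2])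
        (by rw [mulVec_add]; ext r; fin_cases r <;> simp [Q3])
      rw [mulVec_add, add_dotProduct, dotProduct_add, dotProduct_add, ← E, ← E, ← E, ← E, h22,
        h00] at this
      linarith
    ext r s
    fin_cases r <;> fin_cases s <;> simp [h00, h01, h10, h11, h12, h21, h22, ha]

lemma psi_finish (A B F N : Matrix (Fin 3) (Fin 3) ℝ) (Q Q' : Matrix (Fin 3) (Fin 4) ℝ)
    (hA : A.det ≠ 0) (hB : B.det ≠ 0) (hN : ∃ e : ℝ, e ≠ 0 ∧ psi Q Q' = e • N)
    (f : ℝ) (hf : f ≠ 0) (h : Aᵀ * F * B = f • N) :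
    ∃ l : ℝ, l ≠ 0 ∧ l • F = psi (A * Q) (B * Q') := by
  obtain ⟨e, he, hN⟩ := hN
  refine ⟨A.det * B.det * e / f, by positivity, ?_⟩
  have h1 := psi_mul A B Q Q'
  have h2 : Aᵀ * ((A.det * B.det * e / f) • F) * B = Aᵀ * psi (A * Q) (B * Q') * B := by
    rw [h1, hN, Matrix.mul_smul, Matrix.smul_mul, h, smul_smul, smul_smul]
    congr 1
    field_simp
  have uA : IsUnit Aᵀ := by
    rw [Matrix.isUnit_iff_isUnit_det, det_transpose]; exact hA.isUnit
  have uB : IsUnit B := by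
    rw [Matrix.isUnit_iff_isUnit_det]; exact hB.isUnit
  exact uA.mul_left_cancel (uB.mul_right_cancel h2)

lemma ker_one {m n : ℕ} (M : Matrix (Fin m) (Fin n) ℝ) (h : M.rank + 1 = n)
    (u v : Fin n → ℝ) (hu : u ≠ 0) (hMu : M *ᵥ u = 0) (hMv : M *ᵥ v = 0) :
    ∃ c : ℝ, v = c • u := by
  have h1 := LinearMap.finrank_range_add_finrank_ker M.mulVecLin
  have h2 : Module.finrank ℝ (LinearMap.ker M.mulVecLin) = 1 := by
    unfold Matrix.rank at h
    simp at h1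
    omega
  let u' : LinearMap.ker M.mulVecLin := ⟨u, by simpa using hMu⟩
  let v' : LinearMap.ker M.mulVecLin := ⟨v, by simpa using hMv⟩
  have hu' : u' ≠ 0 := fun hh => hu (congrArg Subtype.val hh)
  obtain ⟨c, hc⟩ := (finrank_eq_one_iff_of_nonzero' u' hu').1 h2 v'
  exact ⟨c, (congrArg Subtype.val hc).symm⟩

lemma ker_exists {m n : ℕ} (M : Matrix (Fin m) (Fin n) ℝ) (h : M.rank + 1 = n) :
    ∃ u, u ≠ 0 ∧ M *ᵥ u = 0 := by
  have h1 := LinearMap.finrank_range_add_finrank_ker M.mulVecLin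
  have h2 : Module.finrank ℝ (LinearMap.ker M.mulVecLin) = 1 := by
    unfold Matrix.rank at h
    simp at h1
    omega
  obtain ⟨⟨u, hu⟩, hu0, -⟩ := finrank_eq_one_iff'.1 h2
  exact ⟨u, fun hh => hu0 (Subtype.ext hh), by simpa using hu⟩

lemma li_iff (c₁ c₂ c₃ : Fin 4 → ℝ) :
    (¬ Module.finrank ℝ (Submodule.span ℝ {c₁, c₂, c₃}) ≤ 2) ↔
      ∀ a b c : ℝ, a • c₁ + b • c₂ + c • c₃ = 0 → a = 0 ∧ b = 0 ∧ c = 0 := by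
  have hr : Set.range ![c₁, c₂, c₃] = {c₁, c₂, c₃} := by
    ext z; simp [eq_comm]; tauto
  have h : (¬ Module.finrank ℝ (Submodule.span ℝ {c₁, c₂, c₃}) ≤ 2) ↔
      LinearIndependent ℝ ![c₁, c₂, c₃] := by
    rw [linearIndependent_iff_card_le_finrank_span, Set.finrank, hr]
    simp; omega
  rw [h, Fintype.linearIndependent_iff]
  constructor
  · intro H a b c habc
    have := H ![a, b, c] (by simpa [Fin.sum_univ_succ, add_assoc] using habc)
    exact ⟨this 0, this 1, this 2⟩
  · intro H g hg
    have := H (g 0) (g 1) (g 2) (by simpa [Fin.sum_univ_succ, add_assoc] using hg)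
    intro i
    fin_cases i
    · exact this.1
    · exact this.2.1
    · exact this.2.2

lemma basis_ext (u v : Fin 3 → ℝ) (hv : v ≠ 0) (h : ¬ ∃ c : ℝ, u = c • v) :
    ∃ w, (of ![u, v, w]).det ≠ 0 := by
  have hli : LinearIndependent ℝ ![v, u] := by
    rw [LinearIndependent.pair_iff' hv]
    intro a ha
    exact h ⟨a, ha.symm⟩
  have hx := crossProduct_ne_zero_iff_linearIndependent.2 hli
  refine ⟨crossProduct v u, fun hd => hx ?_⟩
  have : crossProduct v u ⬝ᵥ crossProduct v u = 0 := by
    rw [← neg_eq_zero, ← hd]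
    simp [det_fin_three, crossProduct, dotProduct, Fin.sum_univ_succ]
    ring
  exact dotProduct_self_eq_zero.1 this

lemma left_ker (F : Matrix (Fin 3) (Fin 3) ℝ) (x u v w : Fin 3 → ℝ)
    (hd : (of ![u, v, w]).det ≠ 0) (hu : x ⬝ᵥ (F *ᵥ u) = 0) (hv : x ⬝ᵥ (F *ᵥ v) = 0)
    (hw : x ⬝ᵥ (F *ᵥ w) = 0) : Fᵀ *ᵥ x = 0 := by
  apply Matrix.eq_zero_of_mulVec_eq_zero hd
  rw [dotProduct_mulVec, ← mulVec_transpose, dotProduct_comm] at hu hv hw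
  ext i
  fin_cases i
  · exact hu
  · exact hv
  · exact hw

lemma form_entry (F : Matrix (Fin 3) (Fin 3) ℝ) (X Y : Fin 3 → Fin 3 → ℝ) (i j : Fin 3) :
    ((of X)ᵀᵀ * F * (of Y)ᵀ) i j = X i ⬝ᵥ (F *ᵥ Y j) := by
  rw [transpose_transpose, mul_assoc, mul_apply]
  rfl

lemma cam_rank (A : Matrix (Fin 3) (Fin 3) ℝ) (Q : Matrix (Fin 3) (Fin 4) ℝ) (hA : A.det ≠ 0)
    (hQ : Q * Qᵀ = 1) : IsCamera (A * Q) := by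
  unfold IsCamera
  rw [Matrix.rank_mul_eq_right_of_isUnit_det A Q hA.isUnit]
  apply le_antisymm
  · simpa using Q.rank_le_height
  · have := Matrix.rank_mul_le_left Q Qᵀ
    rw [hQ] at this
    simpa using this

/-- Non-parallelism of two epipoles in one image. -/
lemma fwd_par (P : Matrix (Fin 3) (Fin 4) ℝ) (c₁ c₂ c₃ : Fin 4 → ℝ) (hP : P.rank = 3)
    (h1 : c₁ ≠ 0) (hP1 : P *ᵥ c₁ = 0)
    (hli : ∀ a b c : ℝ, a • c₁ + b • c₂ + c • c₃ = 0 → a = 0 ∧ b = 0 ∧ c = 0)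
    (s t : ℝ) (h : s • (P *ᵥ c₂) = t • (P *ᵥ c₃)) : s = 0 ∧ t = 0 := by
  have hz : P *ᵥ (s • c₂ - t • c₃) = 0 := by
    rw [mulVec_sub, mulVec_smul, mulVec_smul, h, sub_self]
  obtain ⟨k, hk⟩ := ker_one P (by rw [hP]) c₁ _ h1 hP1 hz
  have := hli (-k) s (-t) (by rw [neg_smul, neg_smul, ← hk]; abel)
  exact ⟨this.2.1, by linarith [this.2.2]⟩

/-- Epipoles are images of the other center. -/
lemma epi_right (P₁ P₂ : Matrix (Fin 3) (Fin 4) ℝ) (F : Matrix (Fin 3) (Fin 3) ℝ) (l : ℝ)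
    (hl : l ≠ 0) (hF : F.rank = 2) (h : l • F = psi P₁ P₂) (c : Fin 4 → ℝ) (hc : c ≠ 0)
    (hPc : P₁ *ᵥ c = 0) (e : Fin 3 → ℝ) (he : e ≠ 0) (hk : F *ᵥ e = 0) :
    ∃ k : ℝ, P₂ *ᵥ c = k • e := by
  apply ker_one F (by rw [hF]) e _ he hk
  have : l • (F *ᵥ (P₂ *ᵥ c)) = 0 := by
    rw [← smul_mulVec, h]
    apply dotProduct_eq_zero
    intro x
    rw [dotProduct_comm]
    exact psi_zero P₁ P₂ x _ c 0 1 hc (by simpa using hPc) (by simp)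
  exact (smul_eq_zero.1 this).resolve_left hl

lemma epi_left (P₁ P₂ : Matrix (Fin 3) (Fin 4) ℝ) (F : Matrix (Fin 3) (Fin 3) ℝ) (l : ℝ)
    (hl : l ≠ 0) (hF : F.rank = 2) (h : l • F = psi P₁ P₂) (c : Fin 4 → ℝ) (hc : c ≠ 0)
    (hPc : P₂ *ᵥ c = 0) (e : Fin 3 → ℝ) (he : e ≠ 0) (hk : Fᵀ *ᵥ e = 0) :
    ∃ k : ℝ, P₁ *ᵥ c = k • e := by
  apply ker_one Fᵀ (by rw [rank_transpose, hF]) e _ he hk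
  have : l • (Fᵀ *ᵥ (P₁ *ᵥ c)) = 0 := by
    rw [← smul_mulVec, ← transpose_smul, h]
    apply dotProduct_eq_zero
    intro x
    rw [dotProduct_comm, mulVec_transpose, dotProduct_comm, ← dotProduct_mulVec]
    exact psi_zero P₁ P₂ _ x c 1 0 hc (by simp) (by simpa using hPc)
  exact (smul_eq_zero.1 this).resolve_left hl

lemma fwd_form (P₁ P₂ : Matrix (Fin 3) (Fin 4) ℝ) (F : Matrix (Fin 3) (Fin 3) ℝ) (l : ℝ)
    (hl : l ≠ 0) (h : l • F = psi P₁ P₂) (c : Fin 4 → ℝ) (hc : c ≠ 0) (x y : Fin 3 → ℝ) (s t : ℝ)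
    (h1 : P₁ *ᵥ c = s • x) (h2 : P₂ *ᵥ c = t • y) : x ⬝ᵥ (F *ᵥ y) = 0 := by
  have := psi_zero P₁ P₂ x y c s t hc h1 h2
  rw [← h, smul_mulVec, dotProduct_smul, smul_eq_zero] at this
  exact this.resolve_left hl

lemma par_final (a b p q : Fin 3 → ℝ) (k m : ℝ) (h1 : p = k • a) (h2 : q = m • b)
    (h : ∀ s t : ℝ, s • p = t • q → s = 0 ∧ t = 0) : ¬ ∃ c : ℝ, a = c • b := by
  rintro ⟨c, rfl⟩
  have h3 := h m (k * c) (by rw [h1, h2]; simp only [smul_smul]; congr 1; ring)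
  have h4 : m = 0 := h3.1
  have := h 0 1 (by rw [h2, h4]; simp)
  exact one_ne_zero this.2

theorem stmt8 (F12 F13 F23 : Matrix (Fin 3) (Fin 3) ℝ)
    (hF12 : F12.rank = 2) (hF13 : F13.rank = 2) (hF23 : F23.rank = 2)
    (e12 e13 e21 e23 e31 e32 : Fin 3 → ℝ)
    (he12 : e12 ≠ 0) (hk12 : F12ᵀ *ᵥ e12 = 0)
    (he13 : e13 ≠ 0) (hk13 : F13ᵀ *ᵥ e13 = 0)
    (he21 : e21 ≠ 0) (hk21 : F12 *ᵥ e21 = 0)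
    (he23 : e23 ≠ 0) (hk23 : F23ᵀ *ᵥ e23 = 0)
    (he31 : e31 ≠ 0) (hk31 : F13 *ᵥ e31 = 0)
    (he32 : e32 ≠ 0) (hk32 : F23 *ᵥ e32 = 0) :
    (∃ (P₁ P₂ P₃ : Matrix (Fin 3) (Fin 4) ℝ) (l12 l13 l23 : ℝ),
        IsCamera P₁ ∧ IsCamera P₂ ∧ IsCamera P₃ ∧
        l12 ≠ 0 ∧ l13 ≠ 0 ∧ l23 ≠ 0 ∧
        l12 • F12 = psi P₁ P₂ ∧ l13 • F13 = psi P₁ P₃ ∧ l23 • F23 = psi P₂ P₃ ∧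
        (∀ c₁ c₂ c₃ : Fin 4 → ℝ,
          c₁ ≠ 0 → P₁ *ᵥ c₁ = 0 → c₂ ≠ 0 → P₂ *ᵥ c₂ = 0 → c₃ ≠ 0 → P₃ *ᵥ c₃ = 0 →
          ¬ Module.finrank ℝ (Submodule.span ℝ {c₁, c₂, c₃}) ≤ 2)) ↔
      ((¬ ∃ c : ℝ, e12 = c • e13) ∧ (¬ ∃ c : ℝ, e21 = c • e23) ∧
        (¬ ∃ c : ℝ, e31 = c • e32) ∧
        e13 ⬝ᵥ (F12 *ᵥ e23) = 0 ∧ e12 ⬝ᵥ (F13 *ᵥ e32) = 0 ∧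
        e21 ⬝ᵥ (F23 *ᵥ e31) = 0) := by
  constructor
  · rintro ⟨P₁, P₂, P₃, l12, l13, l23, hP1, hP2, hP3, hl12, hl13, hl23, h12, h13, h23, hc⟩
    unfold IsCamera at hP1 hP2 hP3
    obtain ⟨c₁, n1, z1⟩ := ker_exists P₁ (by rw [hP1])
    obtain ⟨c₂, n2, z2⟩ := ker_exists P₂ (by rw [hP2])
    obtain ⟨c₃, n3, z3⟩ := ker_exists P₃ (by rw [hP3])
    have hli := (li_iff _ _ _).1 (hc c₁ c₂ c₃ n1 z1 n2 z2 n3 z3)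
    obtain ⟨k12, q12⟩ := epi_left P₁ P₂ F12 l12 hl12 hF12 h12 c₂ n2 z2 e12 he12 hk12
    obtain ⟨k13, q13⟩ := epi_left P₁ P₃ F13 l13 hl13 hF13 h13 c₃ n3 z3 e13 he13 hk13
    obtain ⟨k23, q23⟩ := epi_left P₂ P₃ F23 l23 hl23 hF23 h23 c₃ n3 z3 e23 he23 hk23
    obtain ⟨k21, q21⟩ := epi_right P₁ P₂ F12 l12 hl12 hF12 h12 c₁ n1 z1 e21 he21 hk21
    obtain ⟨k31, q31⟩ := epi_right P₁ P₃ F13 l13 hl13 hF13 h13 c₁ n1 z1 e31 he31 hk31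
    obtain ⟨k32, q32⟩ := epi_right P₂ P₃ F23 l23 hl23 hF23 h23 c₂ n2 z2 e32 he32 hk32
    refine ⟨?_, ?_, ?_, ?_, ?_, ?_⟩
    · exact par_final _ _ _ _ _ _ q12 q13 (fwd_par P₁ c₁ c₂ c₃ hP1 n1 z1 hli)
    · refine par_final _ _ _ _ _ _ q21 q23 (fwd_par P₂ c₂ c₁ c₃ hP2 n2 z2 ?_)
      intro a b c h
      have := hli b a c (by rw [← h]; abel)
      tauto
    · refine par_final _ _ _ _ _ _ q31 q32 (fwd_par P₃ c₃ c₁ c₂ hP3 n3 z3 ?_)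
      intro a b c h
      have := hli b c a (by rw [← h]; abel)
      tauto
    · exact fwd_form P₁ P₂ F12 l12 hl12 h12 c₃ n3 _ _ _ _ q13 q23
    · exact fwd_form P₁ P₃ F13 l13 hl13 h13 c₂ n2 _ _ _ _ q12 q32
    · exact fwd_form P₂ P₃ F23 l23 hl23 h23 c₁ n1 _ _ _ _ q21 q31
  · rintro ⟨p1, p2, p3, t12, t13, t23⟩
    obtain ⟨wa, ha⟩ := basis_ext e12 e13 he13 p1
    obtain ⟨wb, hb⟩ := basis_ext e21 e23 he23 p2
    obtain ⟨wd, hd⟩ := basis_ext e31 e32 he32 p3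
    -- kernels as forms
    have kr : ∀ (F : Matrix (Fin 3) (Fin 3) ℝ) (e : Fin 3 → ℝ), Fᵀ *ᵥ e = 0 →
        ∀ y, e ⬝ᵥ (F *ᵥ y) = 0 := by
      intro F e h y
      rw [dotProduct_mulVec, ← mulVec_transpose, h, zero_dotProduct]
    have tr : ∀ (F : Matrix (Fin 3) (Fin 3) ℝ) (x y : Fin 3 → ℝ),
        y ⬝ᵥ (Fᵀ *ᵥ x) = x ⬝ᵥ (F *ᵥ y) := by
      intro F x y
      rw [mulVec_transpose, dotProduct_comm, dotProduct_mulVec]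
    have f34 : e13 ⬝ᵥ (F12 *ᵥ wb) ≠ 0 := fun h => by
      have h' := left_ker F12 e13 e21 e23 wb hb (by simp [hk21]) t12 h
      exact p1 (ker_one F12ᵀ (by rw [rank_transpose, hF12]) _ _ he13 h' hk12)
    have f43 : wa ⬝ᵥ (F12 *ᵥ e23) ≠ 0 := fun h => by
      have h' := left_ker F12ᵀ e23 e12 e13 wa ha (by simp [hk12]) (by rw [tr]; exact t12)
        (by rw [tr]; exact h)
      rw [transpose_transpose] at h'
      exact p2 (ker_one F12 (by rw [hF12]) _ _ he23 h' hk21)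
    have g24 : e12 ⬝ᵥ (F13 *ᵥ wd) ≠ 0 := fun h => by
      have h' := left_ker F13 e12 e31 e32 wd hd (by simp [hk31]) t13 h
      obtain ⟨c, hc⟩ := ker_one F13ᵀ (by rw [rank_transpose, hF13]) _ _ he13 hk13 h'
      exact p1 ⟨c, hc⟩
    have g42 : wa ⬝ᵥ (F13 *ᵥ e32) ≠ 0 := fun h => by
      have h' := left_ker F13ᵀ e32 e12 e13 wa ha (by rw [tr]; exact t13) (by simp [hk13])
        (by rw [tr]; exact h)
      rw [transpose_transpose] at h'
      exact p3 (ker_one F13 (by rw [hF13]) _ _ he32 h' hk31)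
    have h14 : e21 ⬝ᵥ (F23 *ᵥ wd) ≠ 0 := fun h => by
      have h' := left_ker F23 e21 e31 e32 wd hd t23 (by simp [hk32]) h
      exact p2 (ker_one F23ᵀ (by rw [rank_transpose, hF23]) _ _ he23 hk23 h')
    have h41 : wb ⬝ᵥ (F23 *ᵥ e31) ≠ 0 := fun h => by
      have h' := left_ker F23ᵀ e31 e21 e23 wb hb (by rw [tr]; exact t23) (by simp [hk23])
        (by rw [tr]; exact h)
      rw [transpose_transpose] at h'
      exact p3 (ker_one F23 (by rw [hF23]) _ _ he32 hk32 h')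
    obtain ⟨q, hq⟩ : ∃ q : ℝ, wa ⬝ᵥ (F12 *ᵥ wb) + q * (e13 ⬝ᵥ (F12 *ᵥ wb)) = 0 :=
      ⟨-(wa ⬝ᵥ (F12 *ᵥ wb)) / (e13 ⬝ᵥ (F12 *ᵥ wb)), by field_simp; ring⟩
    obtain ⟨p, hp⟩ : ∃ q : ℝ, wa ⬝ᵥ (F13 *ᵥ wd) + q * (e12 ⬝ᵥ (F13 *ᵥ wd)) = 0 :=
      ⟨-(wa ⬝ᵥ (F13 *ᵥ wd)) / (e12 ⬝ᵥ (F13 *ᵥ wd)), by field_simp; ring⟩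
    obtain ⟨u, hu⟩ : ∃ q : ℝ, wb ⬝ᵥ (F23 *ᵥ wd) + q * (e21 ⬝ᵥ (F23 *ᵥ wd)) = 0 :=
      ⟨-(wb ⬝ᵥ (F23 *ᵥ wd)) / (e21 ⬝ᵥ (F23 *ᵥ wd)), by field_simp; ring⟩
    obtain ⟨s3, hs3, ns3⟩ : ∃ s : ℝ, wa ⬝ᵥ (F12 *ᵥ e23) = -(s * (e13 ⬝ᵥ (F12 *ᵥ wb))) ∧ s ≠ 0 :=
      ⟨-(wa ⬝ᵥ (F12 *ᵥ e23)) / (e13 ⬝ᵥ (F12 *ᵥ wb)), by field_simp,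
        div_ne_zero (neg_ne_zero.2 f43) f34⟩
    obtain ⟨s2, hs2, ns2⟩ : ∃ s : ℝ, wa ⬝ᵥ (F13 *ᵥ e32) = -(s * (e12 ⬝ᵥ (F13 *ᵥ wd))) ∧ s ≠ 0 :=
      ⟨-(wa ⬝ᵥ (F13 *ᵥ e32)) / (e12 ⬝ᵥ (F13 *ᵥ wd)), by field_simp,
        div_ne_zero (neg_ne_zero.2 g42) g24⟩
    obtain ⟨t, ht, nt⟩ : ∃ s : ℝ, wb ⬝ᵥ (F23 *ᵥ e31) = -(s * (e21 ⬝ᵥ (F23 *ᵥ wd))) ∧ s ≠ 0 :=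
      ⟨-(wb ⬝ᵥ (F23 *ᵥ e31)) / (e21 ⬝ᵥ (F23 *ᵥ wd)), by field_simp,
        div_ne_zero (neg_ne_zero.2 h41) h14⟩
    have dA : ((of ![s2 • e12, s3 • e13, wa + p • e12 + q • e13])ᵀ).det ≠ 0 := by
      have : ((of ![s2 • e12, s3 • e13, wa + p • e12 + q • e13])ᵀ).det
          = s2 * s3 * (of ![e12, e13, wa]).det := by
        rw [det_transpose]; simp [det_fin_three]; ring
      rw [this]; positivity
    have dB : ((of ![t • e21, e23, wb + u • e21])ᵀ).det ≠ 0 := by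
      have : ((of ![t • e21, e23, wb + u • e21])ᵀ).det
          = t * (of ![e21, e23, wb]).det := by
        rw [det_transpose]; simp [det_fin_three]; ring
      rw [this]; positivity
    have dD : ((of ![e31, e32, wd])ᵀ).det ≠ 0 := by
      rw [det_transpose]; exact hd
    obtain ⟨l12, hl12, H12⟩ := psi_finish _ _ F12 _ Q1 Q2 dA dB psi12 (s3 * (e13 ⬝ᵥ (F12 *ᵥ wb)))
      (mul_ne_zero ns3 f34) (by
        ext i j
        rw [form_entry]
        fin_cases i <;> fin_cases j <;>
          simp [mulVec_add, mulVec_smul, hk21, kr F12 e12 hk12, t12, hs3, hq])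
    obtain ⟨l13, hl13, H13⟩ := psi_finish _ _ F13 _ Q1 Q3 dA dD psi13 (s2 * (e12 ⬝ᵥ (F13 *ᵥ wd)))
      (mul_ne_zero ns2 g24) (by
        ext i j
        rw [form_entry]
        fin_cases i <;> fin_cases j <;>
          simp [hk31, kr F13 e13 hk13, t13, hs2, hp])
    obtain ⟨l23, hl23, H23⟩ := psi_finish _ _ F23 _ Q2 Q3 dB dD psi23 (t * (e21 ⬝ᵥ (F23 *ᵥ wd)))
      (mul_ne_zero nt h14) (by
        ext i j
        rw [form_entry]
        fin_cases i <;> fin_cases j <;>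
          simp [hk32, kr F23 e23 hk23, t23, ht, hu])
    refine ⟨_, _, _, l12, l13, l23, cam_rank _ Q1 dA ?_, cam_rank _ Q2 dB ?_, cam_rank _ Q3 dD ?_,
      hl12, hl13, hl23, H12, H13, H23, ?_⟩
    · ext i j
      fin_cases i <;> fin_cases j <;> simp [Q1, mul_apply, Fin.sum_univ_succ]
    · ext i j
      fin_cases i <;> fin_cases j <;> simp [Q2, mul_apply, Fin.sum_univ_succ]
    · ext i j
      fin_cases i <;> fin_cases j <;> simp [Q3, mul_apply, Fin.sum_univ_succ]
    · intro c₁ c₂ c₃ n1 z1 n2 z2 n3 z3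
      rw [← mulVec_mulVec] at z1 z2 z3
      have z1 := Matrix.eq_zero_of_mulVec_eq_zero dA z1
      have z2 := Matrix.eq_zero_of_mulVec_eq_zero dB z2
      have z3 := Matrix.eq_zero_of_mulVec_eq_zero dD z3
      have x1 : c₁ 1 = 0 ∧ c₁ 2 = 0 ∧ c₁ 3 = 0 := by
        refine ⟨?_, ?_, ?_⟩
        · simpa [Q1, mulVec, dotProduct, Fin.sum_univ_succ] using congrFun z1 0
        · simpa [Q1, mulVec, dotProduct, Fin.sum_univ_succ] using congrFun z1 1
        · simpa [Q1, mulVec, dotProduct, Fin.sum_univ_succ] using congrFun z1 2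
      have x2 : c₂ 0 = 0 ∧ c₂ 2 = 0 ∧ c₂ 3 = 0 := by
        refine ⟨?_, ?_, ?_⟩
        · simpa [Q2, mulVec, dotProduct, Fin.sum_univ_succ] using congrFun z2 0
        · simpa [Q2, mulVec, dotProduct, Fin.sum_univ_succ] using congrFun z2 1
        · simpa [Q2, mulVec, dotProduct, Fin.sum_univ_succ] using congrFun z2 2
      have x3 : c₃ 0 = 0 ∧ c₃ 1 = 0 ∧ c₃ 3 = 0 := by
        refine ⟨?_, ?_, ?_⟩
        · simpa [Q3, mulVec, dotProduct, Fin.sum_univ_succ] using congrFun z3 0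
        · simpa [Q3, mulVec, dotProduct, Fin.sum_univ_succ] using congrFun z3 1
        · simpa [Q3, mulVec, dotProduct, Fin.sum_univ_succ] using congrFun z3 2
      have y1 : c₁ 0 ≠ 0 := fun h => n1 (by ext i; fin_cases i <;> simp [h, x1])
      have y2 : c₂ 1 ≠ 0 := fun h => n2 (by ext i; fin_cases i <;> simp [h, x2])
      have y3 : c₃ 2 ≠ 0 := fun h => n3 (by ext i; fin_cases i <;> simp [h, x3])
      rw [li_iff]
      intro a b c h
      have w0 := congrFun h 0
      have w1 := congrFun h 1
      have w2 := congrFun h 2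
      simp [x1, x2, x3, y1, y2, y3] at w0 w1 w2
      exact ⟨w0, w1, w2⟩
end

section
/- Let F¹², F¹³, F²³ be fundamental matrices with epipoles e_j^i. There exist cameras P₁, P₂, P₃ with collinear centers and nonzero scalars λ_{ij} such that λ_{ij} F^{ij} = ψ(Pᵢ,Pⱼ) for all i < j if and only if: e₁² is parallel to e₁³, e₂¹ is parallel to e₂³, e₃¹ is parallel to e₃², and there exists a nonzero real scalar μ with (F¹²)ᵀ [e₁²]ₓ F¹³ = μ F²³. -/
open Matrix

/-- `crossMat t` is the skew-symmetric matrix `[t]ₓ` with `[t]ₓ u = t × u`. -/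
def crossMat (t : Fin 3 → ℝ) : Matrix (Fin 3) (Fin 3) ℝ :=
  !![0, -t 2, t 1; t 2, 0, -t 0; -t 1, t 0, 0]

/-- The 4×4 matrix of rows entering an entry of `psi`. -/
def rows4 (P Q : Matrix (Fin 3) (Fin 4) ℝ) (a b : Fin 3) : Matrix (Fin 4) (Fin 4) ℝ :=
  Matrix.of ![P (a + 1), P (a + 2), Q (b + 1), Q (b + 2)]

/-- Row order that makes the 6×6 matrix block triangular. -/
def rowFun : Fin 3 → Fin 3 → Fin 6 → Fin 6 := fun a b =>
  ![(a + 1).castAdd 3, (a + 2).castAdd 3, (b + 1).natAdd 3, (b + 2).natAdd 3,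
    a.castAdd 3, b.natAdd 3]

def tau0 : Equiv.Perm (Fin 6) :=
  ⟨![1, 2, 4, 5, 0, 3], ![4, 0, 1, 5, 2, 3], by decide, by decide⟩
def rotP : Equiv.Perm (Fin 6) :=
  ⟨![1, 2, 0, 3, 4, 5], ![2, 0, 1, 3, 4, 5], by decide, by decide⟩
def rotQ : Equiv.Perm (Fin 6) :=
  ⟨![0, 1, 2, 4, 5, 3], ![0, 1, 2, 5, 3, 4], by decide, by decide⟩

lemma rowPerm (a b : Fin 3) : ∃ s : Equiv.Perm (Fin 6), Equiv.Perm.sign s = 1 ∧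
    (∀ i, s i = rowFun a b i) := by
  refine ⟨rotP ^ (a : ℕ) * rotQ ^ (b : ℕ) * tau0, ?_, ?_⟩
  · have h1 : Equiv.Perm.sign rotP = 1 := by decide
    have h2 : Equiv.Perm.sign rotQ = 1 := by decide
    have h3 : Equiv.Perm.sign tau0 = 1 := by decide
    simp [h1, h2, h3]
  · revert a b; decide

lemma psi_eq (P Q : Matrix (Fin 3) (Fin 4) ℝ) (a b : Fin 3) :
    psi P Q a b = (rows4 P Q a b).det := by
  unfold psi
  obtain ⟨s, hs, hr⟩ := rowPerm a b
  have h1 := Matrix.det_permute s (bigMat P Q (Pi.single a 1) (Pi.single b 1))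
  rw [hs] at h1
  simp only [Units.val_one, Int.cast_one, one_mul] at h1
  rw [← h1, ← Matrix.det_submatrix_equiv_self (finSumFinEquiv : Fin 4 ⊕ Fin 2 ≃ Fin 6)]
  have h2 : ((bigMat P Q (Pi.single a 1) (Pi.single b 1)).submatrix s id).submatrix
      (finSumFinEquiv : Fin 4 ⊕ Fin 2 ≃ Fin 6) (finSumFinEquiv : Fin 4 ⊕ Fin 2 ≃ Fin 6) =
      fromBlocks (rows4 P Q a b) 0 (Matrix.of ![P a, Q b]) 1 := by
    ext i j
    rcases i with i | i <;> rcases j with j | j <;>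
      simp only [submatrix_apply, hr, id, finSumFinEquiv_apply_left, finSumFinEquiv_apply_right,
        fromBlocks_apply₁₁, fromBlocks_apply₁₂, fromBlocks_apply₂₁, fromBlocks_apply₂₂]
    · fin_cases i <;> simp [rowFun, bigMat, rows4]
    · fin_cases i <;> fin_cases j <;> simp [rowFun, bigMat, Pi.single_apply]
    · fin_cases i <;> simp [rowFun, bigMat]
    · fin_cases i <;> fin_cases j <;> simp [rowFun, bigMat]
  rw [h2, det_fromBlocks_zero₁₂]
  simp

lemma psi_mul_s9 (P Q : Matrix (Fin 3) (Fin 4) ℝ) (H : Matrix (Fin 4) (Fin 4) ℝ) :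
    psi (P * H) (Q * H) = H.det • psi P Q := by
  ext a b
  rw [Matrix.smul_apply, psi_eq, psi_eq, smul_eq_mul, mul_comm, ← det_mul]
  congr 1
  ext i j
  fin_cases i <;> simp [rows4, Matrix.mul_apply]

lemma psi_transpose (P Q : Matrix (Fin 3) (Fin 4) ℝ) : (psi P Q)ᵀ = psi Q P := by
  ext a b
  rw [Matrix.transpose_apply, psi_eq, psi_eq]
  have h := Matrix.det_permute (Equiv.swap 0 2 * Equiv.swap 1 3 : Equiv.Perm (Fin 4))
    (rows4 P Q b a)
  have hs : Equiv.Perm.sign (Equiv.swap 0 2 * Equiv.swap 1 3 : Equiv.Perm (Fin 4)) = 1 := by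
    decide
  rw [hs] at h
  simp only [Units.val_one, Int.cast_one, one_mul] at h
  rw [← h]
  congr 1
  ext i j
  fin_cases i <;> simp [rows4, Equiv.swap_apply_def]

lemma psi_eq_zero (P Q : Matrix (Fin 3) (Fin 4) ℝ) (c : Fin 4 → ℝ) (hc : c ≠ 0)
    (hP : P *ᵥ c = 0) (hQ : Q *ᵥ c = 0) : psi P Q = 0 := by
  ext a b
  rw [psi_eq]
  apply Matrix.exists_mulVec_eq_zero_iff.mp
  refine ⟨c, hc, ?_⟩
  ext i
  have h1 := congrFun hP
  have h2 := congrFun hQ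
  simp only [mulVec, Pi.zero_apply] at h1 h2
  fin_cases i <;> simp [rows4, mulVec, h1, h2]

lemma det4 (r0 r1 r2 r3 : Fin 4 → ℝ) : (Matrix.of ![r0, r1, r2, r3]).det =
    (r0 0 * r1 1 - r0 1 * r1 0) * (r2 2 * r3 3 - r2 3 * r3 2)
    - (r0 0 * r1 2 - r0 2 * r1 0) * (r2 1 * r3 3 - r2 3 * r3 1)
    + (r0 0 * r1 3 - r0 3 * r1 0) * (r2 1 * r3 2 - r2 2 * r3 1)
    + (r0 1 * r1 2 - r0 2 * r1 1) * (r2 0 * r3 3 - r2 3 * r3 0)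
    - (r0 1 * r1 3 - r0 3 * r1 1) * (r2 0 * r3 2 - r2 2 * r3 0)
    + (r0 2 * r1 3 - r0 3 * r1 2) * (r2 0 * r3 1 - r2 1 * r3 0) := by
  simp [det_succ_row_zero, Fin.sum_univ_succ, Fin.succAbove]
  ring

lemma cramer5 (r0 r1 s0 s1 s2 c : Fin 4 → ℝ) (h0 : r0 ⬝ᵥ c = 0) (h1 : r1 ⬝ᵥ c = 0) :
    (Matrix.of ![r0, r1, s1, s2]).det * (s0 ⬝ᵥ c) + (Matrix.of ![r0, r1, s2, s0]).det * (s1 ⬝ᵥ c)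
     + (Matrix.of ![r0, r1, s0, s1]).det * (s2 ⬝ᵥ c) = 0 := by
  have key : (Matrix.of ![r0, r1, s1, s2]).det * (s0 ⬝ᵥ c)
      + (Matrix.of ![r0, r1, s2, s0]).det * (s1 ⬝ᵥ c)
     + (Matrix.of ![r0, r1, s0, s1]).det * (s2 ⬝ᵥ c) =
     - (Matrix.of ![r1, s0, s1, s2]).det * (r0 ⬝ᵥ c)
     + (Matrix.of ![r0, s0, s1, s2]).det * (r1 ⬝ᵥ c) := by
    simp only [det4, dotProduct, Fin.sum_univ_four]
    ring
  rw [key, h0, h1]; ring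

lemma psi_mulVec (P Q : Matrix (Fin 3) (Fin 4) ℝ) (c : Fin 4 → ℝ) (hP : P *ᵥ c = 0) :
    psi P Q *ᵥ (Q *ᵥ c) = 0 := by
  ext a
  have h := cramer5 (P (a+1)) (P (a+2)) (Q 0) (Q 1) (Q 2) c (congrFun hP _) (congrFun hP _)
  have e : ∀ b, psi P Q a b = (rows4 P Q a b).det := psi_eq P Q a
  simp only [mulVec, Pi.zero_apply]
  rw [dotProduct, Fin.sum_univ_three, e, e, e]
  exact h

lemma ker_line {m n : ℕ} (F : Matrix (Fin m) (Fin n) ℝ) (hF : F.rank + 1 = n)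
    (u v : Fin n → ℝ) (hu : u ≠ 0) (hFu : F *ᵥ u = 0) (hFv : F *ᵥ v = 0) :
    ∃ c : ℝ, v = c • u := by
  have h1 := F.mulVecLin.finrank_range_add_finrank_ker
  simp only [Module.finrank_fin_fun] at h1
  have h2 : Module.finrank ℝ (LinearMap.ker F.mulVecLin) = 1 := by
    unfold Matrix.rank at hF
    omega
  have h3 := (finrank_eq_one_iff_of_nonzero'
    (⟨u, by simpa using hFu⟩ : LinearMap.ker F.mulVecLin)
    (by intro h; exact hu (congrArg Subtype.val h))).mp h2 ⟨v, by simpa using hFv⟩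
  obtain ⟨c, hc⟩ := h3
  exact ⟨c, (congrArg Subtype.val hc).symm⟩

/-- Normal form of the key identity. -/
lemma key_normal (P Q R : Matrix (Fin 3) (Fin 4) ℝ) (t : ℝ)
    (hP : ∀ i, P i 3 = 0) (hQ : ∀ i, Q i 2 = 0) (hR : ∀ i, R i 2 = t * R i 3) :
    t • ((psi P Q)ᵀ * crossMat (fun i => P i 2) * psi P R) =
      (-((P 0 2 ^ 2 + P 1 2 ^ 2 + P 2 2 ^ 2) *
        (P.submatrix id (Fin.castSucc : Fin 3 → Fin 4)).det)) • psi Q R := by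
  have h1 : psi P Q = vecMulVec (crossProduct (fun i => P i 1) (fun i => P i 2))
        (crossProduct (fun i => Q i 0) (fun i => Q i 3)) -
      vecMulVec (crossProduct (fun i => P i 0) (fun i => P i 2))
        (crossProduct (fun i => Q i 1) (fun i => Q i 3)) := by
    ext a b
    rw [psi_eq, rows4, det4]
    fin_cases a <;> fin_cases b <;> simp [vecMulVec_apply, cross_apply, hP, hQ] <;> ring
  have h2 : psi P R = vecMulVec (crossProduct (fun i => P i 1) (fun i => P i 2))
        (crossProduct (fun i => R i 0) (fun i => R i 3)) -
      vecMulVec (crossProduct (fun i => P i 0) (fun i => P i 2))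
        (crossProduct (fun i => R i 1) (fun i => R i 3)) := by
    ext a b
    rw [psi_eq, rows4, det4]
    fin_cases a <;> fin_cases b <;> simp [vecMulVec_apply, cross_apply, hP, hR] <;> ring
  have h3 : psi Q R = (-t) • (vecMulVec (crossProduct (fun i => Q i 1) (fun i => Q i 3))
        (crossProduct (fun i => R i 0) (fun i => R i 3)) -
      vecMulVec (crossProduct (fun i => Q i 0) (fun i => Q i 3))
        (crossProduct (fun i => R i 1) (fun i => R i 3))) := by
    ext a b
    rw [psi_eq, rows4, det4]
    fin_cases a <;> fin_cases b <;> simp [vecMulVec_apply, cross_apply, hQ, hR] <;> ring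
  rw [h1, h2, h3]
  generalize crossProduct (fun i => Q i 1) (fun i => Q i 3) = q1
  generalize crossProduct (fun i => Q i 0) (fun i => Q i 3) = q0
  generalize crossProduct (fun i => R i 1) (fun i => R i 3) = r1
  generalize crossProduct (fun i => R i 0) (fun i => R i 3) = r0
  ext a b
  simp only [Matrix.smul_apply, Matrix.mul_apply, Fin.sum_univ_three, transpose_apply,
    Matrix.sub_apply, vecMulVec_apply, crossMat, cross_apply, det_fin_three, submatrix_apply,
    smul_eq_mul]
  simp
  ring

/-- For cameras with distinct collinear centers, the third matrix is determined. -/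
lemma key (P Q R : Matrix (Fin 3) (Fin 4) ℝ) (hP : P.rank = 3) (c d : Fin 4 → ℝ) (α β : ℝ)
    (hc : c ≠ 0) (hα : α ≠ 0) (hβ : β ≠ 0) (hPc : P *ᵥ c = 0) (hQd : Q *ᵥ d = 0)
    (hPd : P *ᵥ d ≠ 0) (hR : R *ᵥ (α • c + β • d) = 0) :
    ∃ κ : ℝ, κ ≠ 0 ∧ (psi P Q)ᵀ * crossMat (P *ᵥ d) * psi P R = κ • psi Q R := by
  -- complete `d, c` to a basis
  have hd : LinearIndependent ℝ ![d, c] := by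
    rw [LinearIndependent.pair_iff]
    intro s t h
    have h1 : P *ᵥ (s • d + t • c) = 0 := by rw [h, mulVec_zero]
    rw [mulVec_add, mulVec_smul, mulVec_smul, hPc, smul_zero, add_zero] at h1
    have hs : s = 0 := (smul_eq_zero.mp h1).resolve_right hPd
    subst hs
    rw [zero_smul, zero_add] at h
    exact ⟨rfl, (smul_eq_zero.mp h).resolve_right hc⟩
  obtain ⟨f, hf⟩ : ∃ f : Fin 4 → ℝ, LinearIndependent ℝ ![f, d, c] := by
    have := exists_linearIndependent_cons_of_lt_finrank hd (by simp)
    exact this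
  obtain ⟨g, hg⟩ : ∃ g : Fin 4 → ℝ, LinearIndependent ℝ ![g, f, d, c] := by
    have := exists_linearIndependent_cons_of_lt_finrank hf (by simp)
    exact this
  set H : Matrix (Fin 4) (Fin 4) ℝ := (Matrix.of ![g, f, d, c])ᵀ with hH
  have hdet : H.det ≠ 0 := by
    rw [hH, det_transpose]
    have : IsUnit (Matrix.of ![g, f, d, c]) := Matrix.linearIndependent_rows_iff_isUnit.mp hg
    exact ((Matrix.isUnit_iff_isUnit_det _).mp this).ne_zero
  have col2 : ∀ (M : Matrix (Fin 3) (Fin 4) ℝ) i, (M * H) i 2 = (M *ᵥ d) i := by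
    intro M i; simp [hH, Matrix.mul_apply, mulVec, dotProduct]
  have col3 : ∀ (M : Matrix (Fin 3) (Fin 4) ℝ) i, (M * H) i 3 = (M *ᵥ c) i := by
    intro M i; simp [hH, Matrix.mul_apply, mulVec, dotProduct]
  have hk := key_normal (P * H) (Q * H) (R * H) (-(α / β))
    (fun i => by rw [col3, hPc]; rfl) (fun i => by rw [col2, hQd]; rfl)
    (fun i => by
      rw [col2, col3]
      have := congrFun hR i
      simp only [mulVec_add, mulVec_smul, Pi.add_apply, Pi.smul_apply, smul_eq_mul,
        Pi.zero_apply] at this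
      field_simp
      linarith)
  have hm : ((P * H).submatrix id (Fin.castSucc : Fin 3 → Fin 4)).det ≠ 0 := by
    intro h0
    obtain ⟨z, hz, hz0⟩ := Matrix.exists_mulVec_eq_zero_iff.mpr h0
    have h1 : P *ᵥ (H *ᵥ ![z 0, z 1, z 2, 0]) = 0 := by
      rw [← hz0, mulVec_mulVec]
      ext i
      simp [mulVec, dotProduct, Fin.sum_univ_succ]
    obtain ⟨k, hk⟩ := ker_line P (by rw [hP]) c _ hc hPc h1
    have h2 : c = H *ᵥ ![0, 0, 0, 1] := by
      ext i; simp [hH, mulVec, dotProduct, Fin.sum_univ_succ]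
    have h3 : H *ᵥ ![z 0, z 1, z 2, -k] = 0 := by
      have : (![z 0, z 1, z 2, -k] : Fin 4 → ℝ) = ![z 0, z 1, z 2, 0] - k • ![0, 0, 0, 1] := by
        ext i; fin_cases i <;> simp
      rw [this, mulVec_sub, mulVec_smul, ← h2, hk, sub_self]
    have h4 := Matrix.eq_zero_of_mulVec_eq_zero hdet h3
    apply hz
    ext i
    fin_cases i
    · simpa using congrFun h4 0
    · simpa using congrFun h4 1
    · simpa using congrFun h4 2
  have hn : (P * H) 0 2 ^ 2 + (P * H) 1 2 ^ 2 + (P * H) 2 2 ^ 2 ≠ 0 := by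
    simp only [col2]
    intro h0
    apply hPd
    have a0 := sq_nonneg ((P *ᵥ d) 0)
    have a1 := sq_nonneg ((P *ᵥ d) 1)
    have a2 := sq_nonneg ((P *ᵥ d) 2)
    ext i
    apply pow_eq_zero_iff (two_ne_zero) |>.mp
    fin_cases i
    · exact (by linarith : ((P *ᵥ d) 0) ^ 2 = 0)
    · exact (by linarith : ((P *ᵥ d) 1) ^ 2 = 0)
    · exact (by linarith : ((P *ᵥ d) 2) ^ 2 = 0)
  have hcol : (fun i => (P * H) i 2) = P *ᵥ d := funext (col2 P)
  rw [hcol, psi_mul_s9, psi_mul_s9, psi_mul_s9] at hk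
  generalize ((P * H) 0 2 ^ 2 + (P * H) 1 2 ^ 2 + (P * H) 2 2 ^ 2) = n at *
  generalize ((P * H).submatrix id (Fin.castSucc : Fin 3 → Fin 4)).det = m at *
  simp only [transpose_smul, Matrix.smul_mul, Matrix.mul_smul, smul_smul] at hk
  have hT : -(α / β) * (H.det * H.det) ≠ 0 :=
    mul_ne_zero (neg_ne_zero.mpr (div_ne_zero hα hβ)) (mul_ne_zero hdet hdet)
  refine ⟨(-(α / β) * (H.det * H.det))⁻¹ * (-(n * m) * H.det), ?_, ?_⟩
  · exact mul_ne_zero (inv_ne_zero hT) (mul_ne_zero (neg_ne_zero.mpr (mul_ne_zero hn hm)) hdet)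
  · rw [mul_smul, ← hk, smul_smul, inv_mul_cancel₀ hT, one_smul]

lemma rank_smul_ne {F M : Matrix (Fin 3) (Fin 3) ℝ} (hF : F.rank = 2) {l : ℝ} (hl : l ≠ 0)
    (h : l • F = M) : M ≠ 0 := by
  rintro rfl
  rw [(smul_eq_zero.mp h).resolve_left hl] at hF
  simp at hF

lemma smul_mulVec_zero {F M : Matrix (Fin 3) (Fin 3) ℝ} {l : ℝ} (hl : l ≠ 0)
    (h : l • F = M) {v : Fin 3 → ℝ} (hv : M *ᵥ v = 0) : F *ᵥ v = 0 := by
  rw [← h, smul_mulVec] at hv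
  exact (smul_eq_zero.mp hv).resolve_left hl

lemma smul_transpose {F M : Matrix (Fin 3) (Fin 3) ℝ} {l : ℝ}
    (h : l • F = M) : l • Fᵀ = Mᵀ := by rw [← h, transpose_smul]

lemma exists_center (P : Matrix (Fin 3) (Fin 4) ℝ) : ∃ c : Fin 4 → ℝ, c ≠ 0 ∧ P *ᵥ c = 0 := by
  have h := Matrix.exists_mulVec_eq_zero_iff.mpr
    (show (Matrix.of ![P 0, P 1, P 2, 0]).det = 0 by
      apply Matrix.det_eq_zero_of_row_eq_zero 3; intro j; rfl)
  obtain ⟨c, hc, h⟩ := h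
  refine ⟨c, hc, ?_⟩
  ext i
  fin_cases i
  · exact congrFun h 0
  · exact congrFun h 1
  · exact congrFun h 2

/-- two vectors killed by both matrices are parallel through a common nonzero vector -/
lemma parallel_of {F G : Matrix (Fin 3) (Fin 3) ℝ} (hF : F.rank = 2) (hG : G.rank = 2)
    {u e e' : Fin 3 → ℝ} (hu : u ≠ 0) (he' : e' ≠ 0) (hFu : F *ᵥ u = 0) (hGu : G *ᵥ u = 0)
    (hFe : F *ᵥ e = 0) (hGe : G *ᵥ e' = 0) : ∃ c : ℝ, e = c • e' := by
  obtain ⟨a, ha⟩ := ker_line F (by rw [hF]) u e hu hFu hFe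
  obtain ⟨b, hb⟩ := ker_line G (by rw [hG]) e' u he' hGe hGu
  exact ⟨a * b, by rw [ha, hb, smul_smul]⟩

lemma forward (F12 F13 F23 : Matrix (Fin 3) (Fin 3) ℝ)
    (hF12 : F12.rank = 2) (hF13 : F13.rank = 2) (hF23 : F23.rank = 2)
    (e12 e13 e21 e23 e31 e32 : Fin 3 → ℝ)
    (he12 : e12 ≠ 0) (hk12 : F12ᵀ *ᵥ e12 = 0)
    (he13 : e13 ≠ 0) (hk13 : F13ᵀ *ᵥ e13 = 0)
    (hk21 : F12 *ᵥ e21 = 0)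
    (he23 : e23 ≠ 0) (hk23 : F23ᵀ *ᵥ e23 = 0)
    (hk31 : F13 *ᵥ e31 = 0)
    (he32 : e32 ≠ 0) (hk32 : F23 *ᵥ e32 = 0)
    (P₁ P₂ P₃ : Matrix (Fin 3) (Fin 4) ℝ) (l12 l13 l23 : ℝ)
    (hP₁ : P₁.rank = 3) (hP₂ : P₂.rank = 3) (hP₃ : P₃.rank = 3)
    (h12 : l12 ≠ 0) (h13 : l13 ≠ 0) (h23 : l23 ≠ 0)
    (H12 : l12 • F12 = psi P₁ P₂) (H13 : l13 • F13 = psi P₁ P₃) (H23 : l23 • F23 = psi P₂ P₃)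
    (hcol : ∀ c₁ c₂ c₃ : Fin 4 → ℝ,
          c₁ ≠ 0 → P₁ *ᵥ c₁ = 0 → c₂ ≠ 0 → P₂ *ᵥ c₂ = 0 → c₃ ≠ 0 → P₃ *ᵥ c₃ = 0 →
          Module.finrank ℝ (Submodule.span ℝ {c₁, c₂, c₃}) ≤ 2) :
      ((∃ c : ℝ, e12 = c • e13) ∧ (∃ c : ℝ, e21 = c • e23) ∧
        (∃ c : ℝ, e31 = c • e32) ∧
        ∃ μ : ℝ, μ ≠ 0 ∧ F12ᵀ * crossMat e12 * F13 = μ • F23) := by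
  obtain ⟨c₁, hc₁, hPc₁⟩ := exists_center P₁
  obtain ⟨c₂, hc₂, hPc₂⟩ := exists_center P₂
  obtain ⟨c₃, hc₃, hPc₃⟩ := exists_center P₃
  have n12 := rank_smul_ne hF12 h12 H12
  have n13 := rank_smul_ne hF13 h13 H13
  have n23 := rank_smul_ne hF23 h23 H23
  have hPd : P₁ *ᵥ c₂ ≠ 0 := fun h0 => n12 (psi_eq_zero _ _ c₂ hc₂ h0 hPc₂)
  have hli : LinearIndependent ℝ ![c₁, c₂] := by
    rw [LinearIndependent.pair_iff]
    intro t s h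
    have h1 : P₁ *ᵥ (t • c₁ + s • c₂) = 0 := by rw [h, mulVec_zero]
    rw [mulVec_add, mulVec_smul, mulVec_smul, hPc₁, smul_zero, zero_add] at h1
    have hs : s = 0 := (smul_eq_zero.mp h1).resolve_right hPd
    subst hs
    rw [zero_smul, add_zero] at h
    exact ⟨(smul_eq_zero.mp h).resolve_right hc₁, rfl⟩
  have hmem : c₃ ∈ Submodule.span ℝ {c₁, c₂} := by
    have h1 : Module.finrank ℝ (Submodule.span ℝ {c₁, c₂}) = 2 := by
      have := finrank_span_eq_card hli
      rw [Matrix.range_cons, Matrix.range_cons, Matrix.range_empty, Set.union_empty,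
        Set.singleton_union] at this
      simpa using this
    have h2 : Submodule.span ℝ {c₁, c₂} ≤ Submodule.span ℝ {c₁, c₂, c₃} := by
      apply Submodule.span_mono
      intro x hx
      simp only [Set.mem_insert_iff, Set.mem_singleton_iff] at hx ⊢
      tauto
    have h3 := Submodule.eq_of_le_of_finrank_le h2
      (by rw [h1]; exact hcol c₁ c₂ c₃ hc₁ hPc₁ hc₂ hPc₂ hc₃ hPc₃)
    rw [h3]
    exact Submodule.subset_span (by simp)
  obtain ⟨α, β, hαβ⟩ := Submodule.mem_span_pair.mp hmem
  have hα : α ≠ 0 := by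
    rintro rfl
    refine n23 (psi_eq_zero _ _ c₃ hc₃ ?_ hPc₃)
    rw [← hαβ, zero_smul, zero_add, mulVec_smul, hPc₂, smul_zero]
  have hβ : β ≠ 0 := by
    rintro rfl
    refine n13 (psi_eq_zero _ _ c₃ hc₃ ?_ hPc₃)
    rw [← hαβ, zero_smul, add_zero, mulVec_smul, hPc₁, smul_zero]
  have hR : P₃ *ᵥ (α • c₁ + β • c₂) = 0 := by rw [hαβ]; exact hPc₃
  -- epipoles
  have E12 : F12ᵀ *ᵥ (P₁ *ᵥ c₂) = 0 := smul_mulVec_zero h12 (smul_transpose H12)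
    (by rw [psi_transpose]; exact psi_mulVec _ _ _ hPc₂)
  have E13 : F13ᵀ *ᵥ (P₁ *ᵥ c₂) = 0 := smul_mulVec_zero h13 (smul_transpose H13) (by
    rw [psi_transpose]
    have := psi_mulVec P₃ P₁ c₃ hPc₃
    rw [← hαβ, mulVec_add, mulVec_smul, mulVec_smul, hPc₁, smul_zero, zero_add,
      mulVec_smul] at this
    exact (smul_eq_zero.mp this).resolve_left hβ)
  have hP21 : P₂ *ᵥ c₁ ≠ 0 := fun h0 => n12 (psi_eq_zero _ _ c₁ hc₁ hPc₁ h0)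
  have E21 : F12 *ᵥ (P₂ *ᵥ c₁) = 0 := smul_mulVec_zero h12 H12 (psi_mulVec _ _ _ hPc₁)
  have E23 : F23ᵀ *ᵥ (P₂ *ᵥ c₁) = 0 := smul_mulVec_zero h23 (smul_transpose H23) (by
    rw [psi_transpose]
    have := psi_mulVec P₃ P₂ c₃ hPc₃
    rw [← hαβ, mulVec_add, mulVec_smul, mulVec_smul, hPc₂, smul_zero, add_zero,
      mulVec_smul] at this
    exact (smul_eq_zero.mp this).resolve_left hα)
  have hP31 : P₃ *ᵥ c₁ ≠ 0 := fun h0 => n13 (psi_eq_zero _ _ c₁ hc₁ hPc₁ h0)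
  have E31 : F13 *ᵥ (P₃ *ᵥ c₁) = 0 := smul_mulVec_zero h13 H13 (psi_mulVec _ _ _ hPc₁)
  have E32 : F23 *ᵥ (P₃ *ᵥ c₁) = 0 := by
    have h0 : F23 *ᵥ (P₃ *ᵥ c₂) = 0 := smul_mulVec_zero h23 H23 (psi_mulVec _ _ _ hPc₂)
    have h1 : F23 *ᵥ (P₃ *ᵥ (α • c₁ + β • c₂)) = 0 := by rw [hR, mulVec_zero]
    simp only [mulVec_add, mulVec_smul, h0, smul_zero, add_zero] at h1
    exact (smul_eq_zero.mp h1).resolve_left hα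
  have r12 : F12ᵀ.rank = 2 := by rw [rank_transpose, hF12]
  have r13 : F13ᵀ.rank = 2 := by rw [rank_transpose, hF13]
  have r23 : F23ᵀ.rank = 2 := by rw [rank_transpose, hF23]
  refine ⟨parallel_of r12 r13 hPd he13 E12 E13 hk12 hk13,
    parallel_of hF12 r23 hP21 he23 E21 E23 hk21 hk23,
    parallel_of hF13 hF23 hP31 he32 E31 E32 hk31 hk32, ?_⟩
  obtain ⟨κ, hκ, hK⟩ := key P₁ P₂ P₃ hP₁ c₁ c₂ α β hc₁ hα hβ hPc₁ hPc₂ hPd hR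
  obtain ⟨a, ha⟩ := ker_line F12ᵀ (by rw [r12]) (P₁ *ᵥ c₂) e12 hPd E12 hk12
  have ha0 : a ≠ 0 := by
    rintro rfl
    exact he12 (by rw [ha, zero_smul])
  have hcm : crossMat e12 = a • crossMat (P₁ *ᵥ c₂) := by
    rw [ha]
    ext i j
    fin_cases i <;> fin_cases j <;> simp [crossMat]
  rw [← H12, ← H13, ← H23] at hK
  simp only [transpose_smul, Matrix.smul_mul, Matrix.mul_smul, smul_smul] at hK
  have hll : l13 * l12 ≠ 0 := mul_ne_zero h13 h12
  refine ⟨a * ((l13 * l12)⁻¹ * (κ * l23)), ?_, ?_⟩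
  · exact mul_ne_zero ha0 (mul_ne_zero (inv_ne_zero hll) (mul_ne_zero hκ h23))
  · rw [hcm, mul_smul, mul_smul, ← hK, smul_smul (l13 * l12)⁻¹]
    rw [inv_mul_cancel₀ hll]
    simp

/-- the camera `[ [e]ₓ Fᵀ + e wᵀ | e ]` -/
def camMat (F : Matrix (Fin 3) (Fin 3) ℝ) (e w : Fin 3 → ℝ) : Matrix (Fin 3) (Fin 4) ℝ :=
  Matrix.of fun i => ![(crossMat e * Fᵀ) i 0 + e i * w 0, (crossMat e * Fᵀ) i 1 + e i * w 1,
    (crossMat e * Fᵀ) i 2 + e i * w 2, e i]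

def camId : Matrix (Fin 3) (Fin 4) ℝ := !![1, 0, 0, 0; 0, 1, 0, 0; 0, 0, 1, 0]

lemma sq3_pos {e : Fin 3 → ℝ} (he : e ≠ 0) : 0 < e 0 ^ 2 + e 1 ^ 2 + e 2 ^ 2 := by
  by_contra h
  apply he
  have a0 := sq_nonneg (e 0)
  have a1 := sq_nonneg (e 1)
  have a2 := sq_nonneg (e 2)
  ext i
  apply pow_eq_zero_iff (two_ne_zero) |>.mp
  fin_cases i
  · exact (by linarith : (e 0) ^ 2 = 0)
  · exact (by linarith : (e 1) ^ 2 = 0)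
  · exact (by linarith : (e 2) ^ 2 = 0)

lemma vec_zero {e g : Fin 3 → ℝ} (he : e ≠ 0) (hd : e 0 * g 0 + e 1 * g 1 + e 2 * g 2 = 0)
    (h0 : e 1 * g 2 - e 2 * g 1 = 0) (h1 : e 2 * g 0 - e 0 * g 2 = 0)
    (h2 : e 0 * g 1 - e 1 * g 0 = 0) : g = 0 := by
  have hp := (sq3_pos he).ne'
  ext i
  apply (mul_eq_zero.mp (?_ : (e 0 ^ 2 + e 1 ^ 2 + e 2 ^ 2) * g i = 0)).resolve_left hp
  fin_cases i
  · change (e 0 ^ 2 + e 1 ^ 2 + e 2 ^ 2) * g 0 = 0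
    linear_combination e 0 * hd + e 2 * h1 - e 1 * h2
  · change (e 0 ^ 2 + e 1 ^ 2 + e 2 ^ 2) * g 1 = 0
    linear_combination e 1 * hd + e 0 * h2 - e 2 * h0
  · change (e 0 ^ 2 + e 1 ^ 2 + e 2 ^ 2) * g 2 = 0
    linear_combination e 2 * hd + e 1 * h0 - e 0 * h1

lemma cam_rank_s9 (F : Matrix (Fin 3) (Fin 3) ℝ) (e w : Fin 3 → ℝ) (hF : F.rank = 2) (he : e ≠ 0)
    (hFe : F *ᵥ e = 0) : (camMat F e w).rank = 3 := by
  have hinj : LinearIndependent ℝ (camMat F e w).row := by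
    rw [← Matrix.vecMul_injective_iff]
    refine (injective_iff_map_eq_zero (camMat F e w).vecMulLinear).mpr ?_
    intro y hy
    rw [Matrix.vecMulLinear_apply] at hy
    have c0 := congrFun hy 0
    have c1 := congrFun hy 1
    have c2 := congrFun hy 2
    have c3 := congrFun hy 3
    simp [camMat, crossMat, vecMul, dotProduct, Fin.sum_univ_three, Matrix.mul_apply]
      at c0 c1 c2 c3
    obtain ⟨k, hk⟩ := ker_line F (by rw [hF]) e
      ![e 1 * y 2 - e 2 * y 1, e 2 * y 0 - e 0 * y 2, e 0 * y 1 - e 1 * y 0] he hFe (by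
        ext i
        fin_cases i
        · simp [mulVec, dotProduct, Fin.sum_univ_three]
          linear_combination w 0 * c3 - c0
        · simp [mulVec, dotProduct, Fin.sum_univ_three]
          linear_combination w 1 * c3 - c1
        · simp [mulVec, dotProduct, Fin.sum_univ_three]
          linear_combination w 2 * c3 - c2)
    have k0 := congrFun hk 0
    have k1 := congrFun hk 1
    have k2 := congrFun hk 2
    simp at k0 k1 k2
    have hk0 : k = 0 := by
      apply (mul_eq_zero.mp (?_ : (e 0 ^ 2 + e 1 ^ 2 + e 2 ^ 2) * k = 0)).resolve_left
        (sq3_pos he).ne'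
      linear_combination - e 0 * k0 - e 1 * k1 - e 2 * k2
    subst hk0
    exact vec_zero he (by linear_combination c3) (by linear_combination k0)
      (by linear_combination k1) (by linear_combination k2)
  simpa using hinj.rank_matrix

lemma camId_rank : camId.rank = 3 := by
  have hinj : LinearIndependent ℝ camId.row := by
    rw [← Matrix.vecMul_injective_iff]
    refine (injective_iff_map_eq_zero camId.vecMulLinear).mpr ?_
    intro y hy
    rw [Matrix.vecMulLinear_apply] at hy
    have c0 := congrFun hy 0
    have c1 := congrFun hy 1
    have c2 := congrFun hy 2
    simp [camId, vecMul, dotProduct, Fin.sum_univ_three] at c0 c1 c2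
    ext i
    fin_cases i <;> simp [c0, c1, c2]
  simpa using hinj.rank_matrix

lemma cam_center (F : Matrix (Fin 3) (Fin 3) ℝ) (e w : Fin 3 → ℝ) (he : e ≠ 0)
    (hFe : F *ᵥ e = 0) (c : Fin 4 → ℝ) (hc : camMat F e w *ᵥ c = 0) :
    Fᵀ *ᵥ ![c 0, c 1, c 2] = 0 := by
  have f0 := congrFun hFe 0
  have f1 := congrFun hFe 1
  have f2 := congrFun hFe 2
  have c0 := congrFun hc 0
  have c1 := congrFun hc 1
  have c2 := congrFun hc 2
  simp [camMat, crossMat, mulVec, dotProduct, Fin.sum_univ_three, Fin.sum_univ_four,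
    Matrix.mul_apply] at c0 c1 c2 f0 f1 f2
  have hs : w 0 * c 0 + w 1 * c 1 + w 2 * c 2 + c 3 = 0 := by
    apply (mul_eq_zero.mp (?_ : (e 0 ^ 2 + e 1 ^ 2 + e 2 ^ 2) * _ = 0)).resolve_left
        (sq3_pos he).ne'
    linear_combination e 0 * c0 + e 1 * c1 + e 2 * c2
  apply vec_zero he
  · simp [mulVec, dotProduct, Fin.sum_univ_three]
    linear_combination c 0 * f0 + c 1 * f1 + c 2 * f2
  · simp [mulVec, dotProduct, Fin.sum_univ_three]
    linear_combination c0 - e 0 * hs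
  · simp [mulVec, dotProduct, Fin.sum_univ_three]
    linear_combination c1 - e 1 * hs
  · simp [mulVec, dotProduct, Fin.sum_univ_three]
    linear_combination c2 - e 2 * hs

lemma psi_cam (F : Matrix (Fin 3) (Fin 3) ℝ) (e w : Fin 3 → ℝ)
    (hFe : F *ᵥ e = 0) :
    (e 0 ^ 2 + e 1 ^ 2 + e 2 ^ 2) • F = psi camId (camMat F e w) := by
  have f0 := congrFun hFe 0
  have f1 := congrFun hFe 1
  have f2 := congrFun hFe 2
  simp [mulVec, dotProduct, Fin.sum_univ_three] at f0 f1 f2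
  ext a b
  rw [psi_eq, rows4, det4]
  fin_cases a
  · fin_cases b <;> simp [camId, camMat, crossMat, Matrix.mul_apply, Fin.sum_univ_three]
    · linear_combination e 0 * f0
    · linear_combination e 1 * f0
    · linear_combination e 2 * f0
  · fin_cases b <;> simp [camId, camMat, crossMat, Matrix.mul_apply, Fin.sum_univ_three]
    · linear_combination e 0 * f1
    · linear_combination e 1 * f1
    · linear_combination e 2 * f1
  · fin_cases b <;> simp [camId, camMat, crossMat, Matrix.mul_apply, Fin.sum_univ_three]
    · linear_combination e 0 * f2
    · linear_combination e 1 * f2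
    · linear_combination e 2 * f2

lemma camId_mulVec (c : Fin 4 → ℝ) : camId *ᵥ c = ![c 0, c 1, c 2] := by
  ext i
  fin_cases i <;> simp [camId, mulVec, dotProduct, Fin.sum_univ_four]

lemma cam_mulVec (F : Matrix (Fin 3) (Fin 3) ℝ) (e w u : Fin 3 → ℝ) (s : ℝ)
    (hu : Fᵀ *ᵥ u = 0) (hs : w 0 * u 0 + w 1 * u 1 + w 2 * u 2 + s = 0) :
    camMat F e w *ᵥ ![u 0, u 1, u 2, s] = 0 := by
  have f0 := congrFun hu 0
  have f1 := congrFun hu 1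
  have f2 := congrFun hu 2
  simp [mulVec, dotProduct, Fin.sum_univ_three] at f0 f1 f2
  ext i
  fin_cases i <;> simp [camMat, crossMat, mulVec, dotProduct, Fin.sum_univ_three,
    Fin.sum_univ_four, Matrix.mul_apply]
  · linear_combination e 0 * hs - e 2 * f1 + e 1 * f2
  · linear_combination e 1 * hs - e 0 * f2 + e 2 * f0
  · linear_combination e 2 * hs - e 1 * f0 + e 0 * f1

lemma backward (F12 F13 F23 : Matrix (Fin 3) (Fin 3) ℝ)
    (hF12 : F12.rank = 2) (hF13 : F13.rank = 2)
    (e12 e13 e21 e31 : Fin 3 → ℝ)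
    (he12 : e12 ≠ 0) (hk12 : F12ᵀ *ᵥ e12 = 0)
    (hk13 : F13ᵀ *ᵥ e13 = 0)
    (he21 : e21 ≠ 0) (hk21 : F12 *ᵥ e21 = 0)
    (he31 : e31 ≠ 0) (hk31 : F13 *ᵥ e31 = 0)
    (hpar : ∃ c : ℝ, e12 = c • e13)
    (μ : ℝ) (hμ : μ ≠ 0) (hF : F12ᵀ * crossMat e12 * F13 = μ • F23) :
    (∃ (P₁ P₂ P₃ : Matrix (Fin 3) (Fin 4) ℝ) (l12 l13 l23 : ℝ),
        IsCamera P₁ ∧ IsCamera P₂ ∧ IsCamera P₃ ∧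
        l12 ≠ 0 ∧ l13 ≠ 0 ∧ l23 ≠ 0 ∧
        l12 • F12 = psi P₁ P₂ ∧ l13 • F13 = psi P₁ P₃ ∧ l23 • F23 = psi P₂ P₃ ∧
        (∀ c₁ c₂ c₃ : Fin 4 → ℝ,
          c₁ ≠ 0 → P₁ *ᵥ c₁ = 0 → c₂ ≠ 0 → P₂ *ᵥ c₂ = 0 → c₃ ≠ 0 → P₃ *ᵥ c₃ = 0 →
          Module.finrank ℝ (Submodule.span ℝ {c₁, c₂, c₃}) ≤ 2)) := by
  have hk13' : F13ᵀ *ᵥ e12 = 0 := by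
    obtain ⟨c, hc⟩ := hpar
    rw [hc, mulVec_smul, hk13, smul_zero]
  have r12 : F12ᵀ.rank = 2 := by rw [rank_transpose, hF12]
  have r13 : F13ᵀ.rank = 2 := by rw [rank_transpose, hF13]
  have p12 := (sq3_pos he12).ne'
  have p21 := (sq3_pos he21).ne'
  have p31 := (sq3_pos he31).ne'
  have H12 := psi_cam F12 e21 0 hk21
  have H13 := psi_cam F13 e31 e12 hk31
  have hId : camId *ᵥ ![e12 0, e12 1, e12 2, 0] = e12 := by
    rw [camId_mulVec]; ext i; fin_cases i <;> rfl
  obtain ⟨κ, hκ, hK⟩ := key camId (camMat F12 e21 0) (camMat F13 e31 e12) camId_rank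
    ![0, 0, 0, 1] ![e12 0, e12 1, e12 2, 0] (-(e12 0 ^ 2 + e12 1 ^ 2 + e12 2 ^ 2)) 1
    (fun h => by simpa using congrFun h 3) (neg_ne_zero.mpr p12) one_ne_zero
    (by rw [camId_mulVec]; ext i; fin_cases i <;> rfl)
    (cam_mulVec _ _ _ _ _ hk12 (by simp)) (by rw [hId]; exact he12)
    (by
      have := cam_mulVec F13 e31 e12 e12 (-(e12 0 ^ 2 + e12 1 ^ 2 + e12 2 ^ 2)) hk13' (by ring)
      rw [← this]
      congr 1
      ext i
      fin_cases i <;> simp)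
  rw [hId, ← H12, ← H13] at hK
  simp only [transpose_smul, Matrix.smul_mul, Matrix.mul_smul, smul_smul, hF] at hK
  refine ⟨camId, camMat F12 e21 0, camMat F13 e31 e12, _, _,
    κ⁻¹ * ((e31 0 ^ 2 + e31 1 ^ 2 + e31 2 ^ 2) * (e21 0 ^ 2 + e21 1 ^ 2 + e21 2 ^ 2) * μ), camId_rank, cam_rank_s9 _ _ _ hF12 he21 hk21,
    cam_rank_s9 _ _ _ hF13 he31 hk31, p21, p31, ?_, H12, H13, ?_, ?_⟩
  rotate_left
  · rw [mul_smul, mul_assoc, hK, smul_smul, inv_mul_cancel₀ hκ, one_smul]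
  · intro c₁ c₂ c₃ _ h1 _ h2 _ h3
    have h2' := cam_center _ _ _ he21 hk21 _ h2
    have h3' := cam_center _ _ _ he31 hk31 _ h3
    rw [camId_mulVec] at h1
    obtain ⟨a, ha⟩ := ker_line F12ᵀ (by rw [r12]) e12 _ he12 hk12 h2'
    obtain ⟨b, hb⟩ := ker_line F13ᵀ (by rw [r13]) e12 _ he12 hk13' h3'
    have gen : ∀ (c : Fin 4 → ℝ) (k : ℝ), ![c 0, c 1, c 2] = k • e12 →
        c ∈ Submodule.span ℝ {![0, 0, 0, 1], ![e12 0, e12 1, e12 2, 0]} := by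
      intro c k h
      rw [Submodule.mem_span_pair]
      refine ⟨c 3, k, ?_⟩
      have g0 := congrFun h 0
      have g1 := congrFun h 1
      have g2 := congrFun h 2
      simp at g0 g1 g2
      ext i
      fin_cases i <;> simp [g0, g1, g2]
    have hle : Submodule.span ℝ {c₁, c₂, c₃} ≤
        Submodule.span ℝ {![0, 0, 0, 1], ![e12 0, e12 1, e12 2, 0]} := by
      rw [Submodule.span_le]
      intro x hx
      simp only [Set.mem_insert_iff, Set.mem_singleton_iff] at hx
      rcases hx with rfl | rfl | rfl
      · exact gen _ 0 (by rw [h1, zero_smul])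
      · exact gen _ _ ha
      · exact gen _ _ hb
    refine (Submodule.finrank_mono hle).trans ?_
    classical
    have := finrank_span_finset_le_card (R := ℝ)
      ({![0, 0, 0, 1], ![e12 0, e12 1, e12 2, 0]} : Finset (Fin 4 → ℝ))
    simp only [Finset.coe_insert, Finset.coe_singleton] at this
    exact this.trans Finset.card_le_two
  · exact mul_ne_zero (inv_ne_zero hκ) (mul_ne_zero (mul_ne_zero p31 p21) hμ)

theorem stmt9 (F12 F13 F23 : Matrix (Fin 3) (Fin 3) ℝ)
    (hF12 : F12.rank = 2) (hF13 : F13.rank = 2) (hF23 : F23.rank = 2)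
    (e12 e13 e21 e23 e31 e32 : Fin 3 → ℝ)
    (he12 : e12 ≠ 0) (hk12 : F12ᵀ *ᵥ e12 = 0)
    (he13 : e13 ≠ 0) (hk13 : F13ᵀ *ᵥ e13 = 0)
    (he21 : e21 ≠ 0) (hk21 : F12 *ᵥ e21 = 0)
    (he23 : e23 ≠ 0) (hk23 : F23ᵀ *ᵥ e23 = 0)
    (he31 : e31 ≠ 0) (hk31 : F13 *ᵥ e31 = 0)
    (he32 : e32 ≠ 0) (hk32 : F23 *ᵥ e32 = 0) :
    (∃ (P₁ P₂ P₃ : Matrix (Fin 3) (Fin 4) ℝ) (l12 l13 l23 : ℝ),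
        IsCamera P₁ ∧ IsCamera P₂ ∧ IsCamera P₃ ∧
        l12 ≠ 0 ∧ l13 ≠ 0 ∧ l23 ≠ 0 ∧
        l12 • F12 = psi P₁ P₂ ∧ l13 • F13 = psi P₁ P₃ ∧ l23 • F23 = psi P₂ P₃ ∧
        (∀ c₁ c₂ c₃ : Fin 4 → ℝ,
          c₁ ≠ 0 → P₁ *ᵥ c₁ = 0 → c₂ ≠ 0 → P₂ *ᵥ c₂ = 0 → c₃ ≠ 0 → P₃ *ᵥ c₃ = 0 →
          Module.finrank ℝ (Submodule.span ℝ {c₁, c₂, c₃}) ≤ 2)) ↔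
      ((∃ c : ℝ, e12 = c • e13) ∧ (∃ c : ℝ, e21 = c • e23) ∧
        (∃ c : ℝ, e31 = c • e32) ∧
        ∃ μ : ℝ, μ ≠ 0 ∧ F12ᵀ * crossMat e12 * F13 = μ • F23) := by
  constructor
  · rintro ⟨P₁, P₂, P₃, l12, l13, l23, hP₁, hP₂, hP₃, h12, h13, h23, H12, H13, H23, hcol⟩
    exact forward F12 F13 F23 hF12 hF13 hF23 e12 e13 e21 e23 e31 e32 he12 hk12 he13 hk13 hk21
      he23 hk23 hk31 he32 hk32 P₁ P₂ P₃ l12 l13 l23 hP₁ hP₂ hP₃ h12 h13 h23 H12 H13 H23 hcol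
  · rintro ⟨hpar, _, _, μ, hμ, hF⟩
    exact backward F12 F13 F23 hF12 hF13 e12 e13 e21 e31 he12 hk12 hk13 he21 hk21 he31 hk31
      hpar μ hμ hF
end
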